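/- Let I, k, m, M be positive integers, and let Q = ⊔_{i∈S} Q_i ⊆ ℤ be a disjoint union over a set S ⊆ ℕ of I indices, where for each i ∈ S, Q_i ⊆ [−4^i m, −4^i m/2) ∪ (4^i m/2, 4^i m] and |Q_i| = M. Then T_k(Q) ≤ 2^{8k} k^k I^k M^{2k−1}. -/

import Mathlib

open Finset

/-- `Tk Q k`: the number of `2k`-tuples from `Q` with equal sums of the two halves. -/
noncomputable def Tk (Q : Finset ℤ) (k : ℕ) : ℕ :=
  Nat.card {f : (Fin k → ℤ) × (Fin k → ℤ) //
    (∀ i, f.1 i ∈ Q) ∧ (∀ i, f.2 i ∈ Q) ∧ ∑ i, f.1 i = ∑ i, f.2 i}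

/-- One step of the recursion when the linear coefficient dominates. -/
theorem newton_growth {e : ℕ → ℝ} {k : ℕ} {N X : ℝ} (hk : 0 < k) (hN : 20 * k ≤ N)
    (hX0 : 0 ≤ X) (hX : 20 * k * N ≤ X ^ 2) (h0 : e 0 = 1)
    (he : ∀ n < 2 * k, |(n + 1) * e (n + 1) - X * e n| ≤ 2 * N * ∑ i ∈ range n, |e i|) :
    ∀ n ≤ 2 * k, 0 < e n ∧ X * ∑ i ∈ range n, |e i| ≤ 5 * k * e n ∧
      X ^ n ≤ 2 ^ n * n.factorial * e n := by
  have hk1 : (1 : ℝ) ≤ k := by exact_mod_cast hk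
  have hX20 : 20 * k ≤ X := by nlinarith
  have hXpos : 0 < X := by linarith
  intro n
  induction n with
  | zero => intro _; simp [h0]
  | succ n ih =>
    intro hn
    obtain ⟨hpos, hsum, hpow⟩ := ih (by omega)
    have hrec := (abs_le.1 (he n (by omega))).1
    have hn' : (n : ℝ) + 1 ≤ 2 * k := by exact_mod_cast hn
    have hsmall : 2 * N * ∑ i ∈ range n, |e i| ≤ X / 2 * e n := by
      have h1 : X * (2 * N * ∑ i ∈ range n, |e i|) ≤ X * (X / 2 * e n) := by
        have : N * (X * ∑ i ∈ range n, |e i|) ≤ N * (5 * k * e n) :=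
          mul_le_mul_of_nonneg_left hsum (by linarith)
        nlinarith
      exact le_of_mul_le_mul_left h1 hXpos
    have hstep : X * e n ≤ 2 * ((n + 1) * e (n + 1)) := by linarith
    have hpos' : 0 < e (n + 1) := by
      have : 0 < X * e n := mul_pos hXpos hpos
      by_contra! h
      have : ((n : ℝ) + 1) * e (n + 1) ≤ 0 := mul_nonpos_of_nonneg_of_nonpos (by positivity) h
      linarith
    refine ⟨hpos', ?_, ?_⟩
    · rw [sum_range_succ, abs_of_pos hpos]
      have h2 : X * e n ≤ 4 * k * e (n + 1) := by nlinarith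
      have h3 : X * ∑ i ∈ range n, |e i| ≤ X / 4 * e n := by nlinarith
      nlinarith
    · rw [Nat.factorial_succ, pow_succ, pow_succ]
      push_cast
      calc X ^ n * X ≤ 2 ^ n * n.factorial * e n * X := by gcongr
        _ = 2 ^ n * n.factorial * (X * e n) := by ring
        _ ≤ 2 ^ n * n.factorial * (2 * ((n + 1) * e (n + 1))) := by gcongr
        _ = _ := by ring

/-- An upper bound for the recursion in terms of a bound for the linear coefficient. -/
theorem newton_upper {e : ℕ → ℝ} {k : ℕ} {N X Y : ℝ} (hk : 0 < k) (hN : 20 * k ≤ N)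
    (hX0 : 0 ≤ X) (hXY : X ≤ Y) (hY : Y ^ 2 = 20 * k * N) (h0 : e 0 = 1)
    (he : ∀ n < 2 * k, |(n + 1) * e (n + 1) - X * e n| ≤ 2 * N * ∑ i ∈ range n, |e i|) :
    ∀ n ≤ 2 * k, |e n| ≤ (5 / 4 * Y) ^ n / n.factorial ∧
      Y * ∑ i ∈ range n, |e i| ≤ 2 * k * ((5 / 4 * Y) ^ n / n.factorial) := by
  have hk1 : (1 : ℝ) ≤ k := by exact_mod_cast hk
  have hY0 : 0 ≤ Y := hX0.trans hXY
  have hY20 : 20 * k ≤ Y := by nlinarith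
  have hYpos : 0 < Y := by linarith
  intro n
  induction n with
  | zero => intro _; simp [h0]
  | succ n ih =>
    intro hn
    obtain ⟨hle, hsum⟩ := ih (by omega)
    have hrec := he n (by omega)
    have hn' : (n : ℝ) + 1 ≤ 2 * k := by exact_mod_cast hn
    set b := (5 / 4 * Y) ^ n / n.factorial with hb
    have hb0 : 0 ≤ b := by positivity
    have hb' : (n + 1) * ((5 / 4 * Y) ^ (n + 1) / (n + 1).factorial) = 5 / 4 * Y * b := by
      rw [hb, Nat.factorial_succ, pow_succ]
      push_cast
      field_simp
    set b' := (5 / 4 * Y) ^ (n + 1) / (n + 1).factorial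
    have hb'0 : 0 ≤ b' := by positivity
    have hsmall : 2 * N * ∑ i ∈ range n, |e i| ≤ Y / 4 * b := by
      have h1 : Y * (2 * N * ∑ i ∈ range n, |e i|) ≤ Y * (Y / 4 * b) := by
        have : N * (Y * ∑ i ∈ range n, |e i|) ≤ N * (2 * k * b) :=
          mul_le_mul_of_nonneg_left hsum (by linarith)
        nlinarith
      exact le_of_mul_le_mul_left h1 hYpos
    constructor
    · have h2 : (n + 1) * |e (n + 1)| ≤ (n + 1) * b' := by
        have h3 : (n + 1) * |e (n + 1)| = |(n + 1) * e (n + 1)| := by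
          rw [abs_mul, abs_of_nonneg (by positivity : (0 : ℝ) ≤ n + 1)]
        have h4 : |(n + 1) * e (n + 1)| ≤ |(n + 1) * e (n + 1) - X * e n| + |X * e n| := by
          simpa using abs_add_le ((n + 1) * e (n + 1) - X * e n) (X * e n)
        have h5 : |X * e n| ≤ Y * b := by
          rw [abs_mul, abs_of_nonneg hX0]; gcongr
        rw [hb', h3]; linarith
      exact le_of_mul_le_mul_left h2 (by positivity)
    · rw [sum_range_succ]
      have h2 : 5 / 4 * Y * b ≤ 2 * k * b' := by rw [← hb']; gcongr
      have h3 : Y * ∑ i ∈ range n, |e i| ≤ Y / 10 * b := by nlinarith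
      nlinarith [mul_le_mul_of_nonneg_left hle hY0]

theorem newton_pow_le {e : ℕ → ℝ} {k : ℕ} {N X : ℝ} (hk : 0 < k) (hN : 20 * k ≤ N)
    (hX0 : 0 ≤ X) (h0 : e 0 = 1)
    (he : ∀ n < 2 * k, |(n + 1) * e (n + 1) - X * e n| ≤ 2 * N * ∑ i ∈ range n, |e i|) :
    X ^ (2 * k) ≤ 4 ^ k * (2 * k).factorial * e (2 * k) + 2 * (125 * k * N) ^ k := by
  have hN0 : 0 ≤ N := le_trans (by positivity) hN
  rcases le_total (20 * k * N) (X ^ 2) with hX | hX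
  · have := (newton_growth hk hN hX0 hX h0 he (2 * k) le_rfl).2.2
    rw [pow_mul 2] at this
    norm_num at this
    have h2 : 0 ≤ (125 * k * N) ^ k := by positivity
    linarith
  · have hY := Real.sq_sqrt (by positivity : 0 ≤ 20 * k * N)
    have hle := (newton_upper hk hN hX0 (Real.le_sqrt_of_sq_le hX) hY h0 he (2 * k) le_rfl).1
    have hfac : (0 : ℝ) < (2 * k).factorial := by positivity
    rw [le_div_iff₀ hfac, pow_mul, mul_pow, hY] at hle
    have h1 : X ^ (2 * k) ≤ (125 * k * N) ^ k := by
      rw [pow_mul]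
      exact pow_le_pow_left₀ (sq_nonneg X) (hX.trans (by nlinarith [(by positivity : 0 ≤ k * N)])) k
    have h2 : (4 : ℝ) ^ k * ((5 / 4) ^ 2 * (20 * k * N)) ^ k = (125 * k * N) ^ k := by
      rw [← mul_pow]; ring
    have h3 : (4 : ℝ) ^ k * (|e (2 * k)| * (2 * k).factorial) ≤ (125 * k * N) ^ k := by
      rw [← h2]; gcongr
    have h4 : -((4 : ℝ) ^ k * (|e (2 * k)| * (2 * k).factorial))
        ≤ 4 ^ k * (2 * k).factorial * e (2 * k) := by
      have : (0 : ℝ) ≤ 4 ^ k * (2 * k).factorial := by positivity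
      nlinarith [neg_abs_le (e (2 * k))]
    linarith

theorem newton_esymm {ι : Type*} [Fintype ι] (x : ι → ℝ) (n : ℕ) :
    ((n : ℝ) + 1) * ∑ A ∈ powersetCard (n + 1) univ, ∏ i ∈ A, x i =
      (-1) ^ n * ∑ j ∈ range (n + 1),
        (-1) ^ j * (∑ A ∈ powersetCard j univ, ∏ i ∈ A, x i) * ∑ i, x i ^ (n + 1 - j) := by
  have h := congrArg (MvPolynomial.aeval x) (MvPolynomial.mul_esymm_eq_sum ι ℝ (n + 1))
  simp only [sum_filter, Nat.sum_antidiagonal_eq_sum_range_succ_mk] at h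
  rw [sum_range_succ] at h
  simp only [lt_irrefl, if_false, add_zero] at h
  rw [sum_congr rfl fun j hj => if_pos (mem_range.1 hj)] at h
  simp only [MvPolynomial.esymm, MvPolynomial.psum, map_mul, map_sum, map_prod, map_pow, map_neg,
    map_one, map_natCast, MvPolynomial.aeval_X] at h
  rw [← Nat.cast_succ, h]
  ring

theorem abs_newton_esymm_le {ι : Type*} [Fintype ι] (x : ι → ℝ) {k : ℕ}
    (hx : ∑ i, x i ^ (2 * k) = Fintype.card ι) {n : ℕ} (hn : n < 2 * k) :
    |((n : ℝ) + 1) * ∑ A ∈ powersetCard (n + 1) univ, ∏ i ∈ A, x i -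
        (∑ i, x i) * ∑ A ∈ powersetCard n univ, ∏ i ∈ A, x i| ≤
      2 * Fintype.card ι * ∑ j ∈ range n, |∑ A ∈ powersetCard j univ, ∏ i ∈ A, x i| := by
  have hp : ∀ j ≤ 2 * k, |∑ i, x i ^ j| ≤ 2 * Fintype.card ι := by
    intro j hj
    calc |∑ i, x i ^ j| ≤ ∑ i, |x i ^ j| := abs_sum_le_sum_abs _ _
      _ ≤ ∑ i, (1 + x i ^ (2 * k)) := by
        refine sum_le_sum fun i _ => ?_
        rw [abs_pow, ← (even_two_mul k).pow_abs]
        rcases le_total |x i| 1 with h | h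
        · linarith [pow_le_one₀ (n := j) (abs_nonneg _) h, pow_nonneg (abs_nonneg (x i)) (2 * k)]
        · linarith [pow_le_pow_right₀ h hj]
      _ = 2 * Fintype.card ι := by
        rw [sum_add_distrib, hx]; simp; ring
  rw [newton_esymm, sum_range_succ, mul_add]
  have hsq : ((-1 : ℝ) ^ n) * (-1) ^ n = 1 := by rw [← mul_pow]; simp
  have : (-1 : ℝ) ^ n * ((-1) ^ n * (∑ A ∈ powersetCard n univ, ∏ i ∈ A, x i) *
      ∑ i, x i ^ (n + 1 - n)) = (∑ i, x i) * ∑ A ∈ powersetCard n univ, ∏ i ∈ A, x i := by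
    rw [Nat.add_sub_cancel_left]
    simp only [pow_one]
    linear_combination
      ((∑ i, x i) * ∑ A ∈ powersetCard n univ, ∏ i ∈ A, x i) * hsq
  rw [this, add_sub_cancel_right, abs_mul, abs_pow, abs_neg, abs_one, one_pow, one_mul, mul_sum]
  refine (abs_sum_le_sum_abs _ _).trans (sum_le_sum fun j _ => ?_)
  rw [abs_mul, abs_mul, abs_pow, abs_neg, abs_one, one_pow, one_mul, mul_comm]
  gcongr
  exact hp _ (by omega)

theorem sum_prod_powersetCard_smul {ι : Type*} [Fintype ι] (c : ℝ) (x : ι → ℝ) (n : ℕ) :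
    ∑ A ∈ powersetCard n univ, ∏ i ∈ A, c * x i =
      c ^ n * ∑ A ∈ powersetCard n univ, ∏ i ∈ A, x i := by
  rw [mul_sum]
  refine sum_congr rfl fun A hA => ?_
  rw [prod_mul_distrib, prod_const, (mem_powersetCard.1 hA).2]

theorem sum_pow_le_of_normalized {ι : Type*} [Fintype ι] (x : ι → ℝ) {k : ℕ} (hk : 0 < k)
    (hc : 20 * k ≤ Fintype.card ι) (hx : ∑ i, x i ^ (2 * k) = Fintype.card ι) :
    (∑ i, x i) ^ (2 * k) ≤
      4 ^ k * (2 * k).factorial * ∑ A ∈ powersetCard (2 * k) univ, ∏ i ∈ A, x i +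
        2 * (125 * k * Fintype.card ι) ^ k := by
  wlog h : 0 ≤ ∑ i, x i generalizing x
  · have := this (fun i => -1 * x i) (by simpa [(even_two_mul k).neg_pow] using hx)
      (by rw [← mul_sum]; linarith)
    rw [← mul_sum, sum_prod_powersetCard_smul] at this
    simpa [(even_two_mul k).neg_pow] using this
  · exact newton_pow_le (e := fun n => ∑ A ∈ powersetCard n univ, ∏ i ∈ A, x i) hk
      (by exact_mod_cast hc) h (by simp) fun n hn => abs_newton_esymm_le x hx hn

/-- A pointwise Khinchin-type inequality, with the elementary symmetric function of degree `2k`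
as error term. -/
theorem sum_pow_le_esymm_add {ι : Type*} [Fintype ι] (x : ι → ℝ) {k : ℕ} (hk : 0 < k)
    (hc : 20 * k ≤ Fintype.card ι) :
    (∑ i, x i) ^ (2 * k) ≤
      4 ^ k * (2 * k).factorial * ∑ A ∈ powersetCard (2 * k) univ, ∏ i ∈ A, x i +
        2 * (125 * k) ^ k * (Fintype.card ι : ℝ) ^ (k - 1) * ∑ i, x i ^ (2 * k) := by
  set N : ℝ := (Fintype.card ι : ℝ) with hN
  have hNpos : 0 < N := by
    rw [hN]; exact_mod_cast (by omega : 0 < Fintype.card ι)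
  set W := ∑ i, x i ^ (2 * k) with hW
  have hterm : ∀ i, 0 ≤ x i ^ (2 * k) := fun i => (even_two_mul k).pow_nonneg _
  have hW0 : 0 ≤ W := sum_nonneg fun i _ => hterm i
  have h2k : 2 * k ≠ 0 := by omega
  rcases hW0.eq_or_lt with h | h
  · have hx : ∀ i, x i = 0 := fun i => by
      have := (sum_eq_zero_iff_of_nonneg fun i _ => hterm i).1 (hW.symm.trans h.symm) i (mem_univ i)
      exact pow_eq_zero_iff h2k |>.1 this
    have he : ∑ A ∈ powersetCard (2 * k) univ, ∏ i ∈ A, x i = 0 := by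
      have := sum_prod_powersetCard_smul 0 x (2 * k)
      simpa [hx, h2k] using this
    rw [he, ← h]
    simp [hx, h2k]
  · set w : ℝ := (W / N) ^ (((2 * k : ℕ) : ℝ)⁻¹)
    have hw : 0 < w := by positivity
    have hwp : w ^ (2 * k) = W / N := Real.rpow_inv_natCast_pow (by positivity) h2k
    have hy : ∑ i, (w⁻¹ * x i) ^ (2 * k) = Fintype.card ι := by
      simp only [mul_pow, inv_pow]
      rw [← mul_sum, hwp, ← hW, ← hN]
      field_simp
    have key := sum_pow_le_of_normalized (fun i => w⁻¹ * x i) hk hc hy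
    rw [← mul_sum, sum_prod_powersetCard_smul, mul_pow, ← hN] at key
    have := mul_le_mul_of_nonneg_left key (pow_pos hw (2 * k)).le
    have hwi : w ^ (2 * k) * w⁻¹ ^ (2 * k) = 1 := by rw [← mul_pow]; simp [hw.ne']
    have hpow : N ^ k = N ^ (k - 1) * N := by rw [← pow_succ]; congr 1; omega
    have hlast : w ^ (2 * k) * (2 * (125 * k * N) ^ k) = 2 * (125 * k) ^ k * N ^ (k - 1) * W := by
      rw [hwp, mul_pow, hpow]; field_simp
    rw [mul_add, hlast, ← mul_assoc, hwi, one_mul] at this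
    refine this.trans (le_of_eq ?_)
    linear_combination (4 ^ k * (2 * k).factorial *
      ∑ A ∈ powersetCard (2 * k) univ, ∏ i ∈ A, x i) * hwi

/-- The exponential `t ↦ exp(i n t)`. -/
noncomputable def expChar (n : ℤ) (t : ℝ) : ℂ := Complex.exp (n * t * Complex.I)

theorem continuous_expChar (n : ℤ) : Continuous (expChar n) := by
  unfold expChar; fun_prop

theorem expChar_add (a b : ℤ) (t : ℝ) : expChar (a + b) t = expChar a t * expChar b t := by
  simp only [expChar, ← Complex.exp_add]; congr 1; push_cast; ring

theorem expChar_zero (t : ℝ) : expChar 0 t = 1 := by simp [expChar]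

theorem expChar_neg (n : ℤ) (t : ℝ) : expChar (-n) t = (starRingEnd ℂ) (expChar n t) := by
  simp [expChar, ← Complex.exp_conj]

theorem expChar_sum {α : Type*} (s : Finset α) (f : α → ℤ) (t : ℝ) :
    expChar (∑ i ∈ s, f i) t = ∏ i ∈ s, expChar (f i) t := by
  simp [expChar, ← Complex.exp_sum, Finset.sum_mul]

theorem expChar_eq (n : ℤ) (t : ℝ) :
    expChar n t = (Real.cos (n * t) : ℂ) + (Real.sin (n * t) : ℂ) * Complex.I := by
  simp [expChar, Complex.exp_mul_I]

theorem norm_expChar (n : ℤ) (t : ℝ) : ‖expChar n t‖ = 1 := by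
  have := Complex.norm_exp_ofReal_mul_I (n * t)
  simpa [expChar] using this

theorem integral_expChar (n : ℤ) :
    ∫ t in (0 : ℝ)..(2 * Real.pi), expChar n t = if n = 0 then (2 * Real.pi : ℂ) else 0 := by
  split_ifs with h
  · simp [h, expChar_zero]
  · have hc : (n : ℂ) * Complex.I ≠ 0 := by simp [h]
    have h1 : ∀ t : ℝ, expChar n t = Complex.exp ((n : ℂ) * Complex.I * t) := fun t => by
      unfold expChar; congr 1; ring
    simp only [h1]
    rw [integral_exp_mul_complex hc]
    have : (n : ℂ) * Complex.I * ((2 * Real.pi : ℝ) : ℂ) = n * (2 * Real.pi * Complex.I) := by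
      push_cast; ring
    rw [this, Complex.exp_int_mul_two_pi_mul_I]
    simp

/-- Trigonometric polynomials with spectrum in `P`. -/
def trigSpan (P : Set ℤ) : Submodule ℂ (ℝ → ℂ) := Submodule.span ℂ (expChar '' P)

theorem trigSpan_mul {P P' R : Set ℤ} (h : ∀ x ∈ P, ∀ y ∈ P', x + y ∈ R) {f g : ℝ → ℂ}
    (hf : f ∈ trigSpan P) (hg : g ∈ trigSpan P') : f * g ∈ trigSpan R := by
  have := Submodule.mul_mem_mul hf hg
  rw [trigSpan, trigSpan, Submodule.span_mul_span] at this
  refine Submodule.span_mono ?_ this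
  rintro _ ⟨_, ⟨x, hx, rfl⟩, _, ⟨y, hy, rfl⟩, rfl⟩
  exact ⟨x + y, h x hx y hy, funext fun t => expChar_add x y t⟩

theorem integral_eq_zero_of_mem_trigSpan {f : ℝ → ℂ} (hf : f ∈ trigSpan {x | x ≠ 0}) :
    ∫ t in (0 : ℝ)..(2 * Real.pi), f t = 0 := by
  suffices Continuous f ∧ ∫ t in (0 : ℝ)..(2 * Real.pi), f t = 0 from this.2
  induction hf using Submodule.span_induction with
  | mem f hf =>
    obtain ⟨n, hn, rfl⟩ := hf
    exact ⟨continuous_expChar n, by rw [integral_expChar, if_neg hn]⟩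
  | zero => exact ⟨continuous_zero, by simp⟩
  | add f g _ _ hf hg =>
    refine ⟨hf.1.add hg.1, ?_⟩
    simp only [Pi.add_apply]
    rw [intervalIntegral.integral_add (hf.1.intervalIntegrable _ _) (hg.1.intervalIntegrable _ _),
      hf.2, hg.2, add_zero]
  | smul c f _ hf =>
    refine ⟨hf.1.const_smul c, ?_⟩
    simp only [Pi.smul_apply]
    rw [intervalIntegral.integral_smul, hf.2, smul_zero]

theorem prod_mem_trigSpan {m : ℕ} {g : ℕ → ℝ → ℂ} (A : Finset ℕ)
    (hg : ∀ i ∈ A, g i ∈ trigSpan {x | 4 ^ i * m < 2 * |x| ∧ |x| ≤ 4 ^ i * m}) :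
    ∀ n, (∀ i ∈ A, i < n) → ∏ i ∈ A, g i ∈ trigSpan {x | 3 * |x| ≤ 4 ^ n * m} := by
  induction A using Finset.induction_on_max with
  | empty =>
    intro n _
    refine Submodule.subset_span ⟨0, ?_, funext fun t => by simp [expChar_zero]⟩
    simp only [Set.mem_ofPred_eq, abs_zero, mul_zero]; positivity
  | insert a A ha ih =>
    intro n hn
    rw [prod_insert fun h => (ha a h).false]
    refine trigSpan_mul ?_ (hg a (mem_insert_self a A))
      (ih (fun i hi => hg i (mem_insert_of_mem hi)) a ha)
    rintro x ⟨_, hx⟩ y hy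
    simp only [Set.mem_ofPred_eq] at hy ⊢
    have h1 : (4 : ℤ) ^ (a + 1) * m ≤ 4 ^ n * m := by
      gcongr
      · norm_num
      · exact hn a (mem_insert_self a A)
    rw [pow_succ] at h1
    have := abs_add_le x y
    linarith

/-- Functions with spectra in well separated scales form a multiplicative system. -/
theorem integral_prod_eq_zero {m : ℕ} {g : ℕ → ℝ → ℂ} {A : Finset ℕ} (hA : A.Nonempty)
    (hg : ∀ i ∈ A, g i ∈ trigSpan {x | 4 ^ i * m < 2 * |x| ∧ |x| ≤ 4 ^ i * m}) :
    ∫ t in (0 : ℝ)..(2 * Real.pi), ∏ i ∈ A, g i t = 0 := by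
  have hmem := A.max'_mem hA
  have h : ∏ i ∈ A, g i ∈ trigSpan {x | x ≠ 0} := by
    rw [← mul_prod_erase A g hmem]
    refine trigSpan_mul ?_ (hg _ hmem) (prod_mem_trigSpan (A.erase (A.max' hA))
      (fun i hi => hg i (mem_of_mem_erase hi)) (A.max' hA)
      fun i hi => A.lt_max'_of_mem_erase_max' hA hi)
    rintro x ⟨hx, _⟩ y hy h0
    simp only [Set.mem_ofPred_eq] at hy
    have : |x| = |y| := by rw [eq_neg_of_add_eq_zero_left h0, abs_neg]
    have := abs_nonneg y
    linarith
  simpa only [Finset.prod_apply] using integral_eq_zero_of_mem_trigSpan h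

theorem sum_cos_mem_trigSpan {P : Set ℤ} (hP : ∀ x ∈ P, -x ∈ P) {Q : Finset ℤ}
    (hQ : ∀ x ∈ Q, x ∈ P) :
    (fun t : ℝ => ((∑ x ∈ Q, Real.cos (x * t) : ℝ) : ℂ)) ∈ trigSpan P := by
  have : (fun t : ℝ => ((∑ x ∈ Q, Real.cos (x * t) : ℝ) : ℂ)) =
      ∑ x ∈ Q, (1 / 2 : ℂ) • (expChar x + expChar (-x)) := by
    funext t
    simp only [Finset.sum_apply, Pi.smul_apply, Pi.add_apply, expChar_eq, Complex.ofReal_sum]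
    refine sum_congr rfl fun x _ => ?_
    simp
    ring
  rw [this]
  exact Submodule.sum_mem _ fun x hx => Submodule.smul_mem _ _ (Submodule.add_mem _
    (Submodule.subset_span ⟨x, hQ x hx, rfl⟩) (Submodule.subset_span ⟨-x, hP x (hQ x hx), rfl⟩))

theorem sum_sin_mem_trigSpan {P : Set ℤ} (hP : ∀ x ∈ P, -x ∈ P) {Q : Finset ℤ}
    (hQ : ∀ x ∈ Q, x ∈ P) :
    (fun t : ℝ => ((∑ x ∈ Q, Real.sin (x * t) : ℝ) : ℂ)) ∈ trigSpan P := by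
  have : (fun t : ℝ => ((∑ x ∈ Q, Real.sin (x * t) : ℝ) : ℂ)) =
      ∑ x ∈ Q, (-Complex.I / 2) • (expChar x - expChar (-x)) := by
    funext t
    simp only [Finset.sum_apply, Pi.smul_apply, Pi.sub_apply, expChar_eq, Complex.ofReal_sum]
    refine sum_congr rfl fun x _ => ?_
    simp
    ring_nf
    simp
  rw [this]
  exact Submodule.sum_mem _ fun x hx => Submodule.smul_mem _ _ (Submodule.sub_mem _
    (Submodule.subset_span ⟨x, hQ x hx, rfl⟩) (Submodule.subset_span ⟨-x, hP x (hQ x hx), rfl⟩))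


theorem integral_norm_expSum_pow (Q : Finset ℤ) (k : ℕ) :
    ∫ t in (0 : ℝ)..(2 * Real.pi), ‖∑ x ∈ Q, expChar x t‖ ^ (2 * k) = 2 * Real.pi * Tk Q k := by
  classical
  set B := Fintype.piFinset fun _ : Fin k => Q with hB
  have hpow : ∀ t, (∑ x ∈ Q, expChar x t) ^ k = ∑ f ∈ B, expChar (∑ i, f i) t := by
    intro t
    have := prod_univ_sum (fun _ : Fin k => Q) (fun _ x => expChar x t)
    simpa [expChar_sum] using this
  have hnorm : ∀ t, ((‖∑ x ∈ Q, expChar x t‖ ^ (2 * k) : ℝ) : ℂ) =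
      ∑ p ∈ B ×ˢ B, expChar (∑ i, p.1 i - ∑ i, p.2 i) t := by
    intro t
    have h1 : ((‖∑ x ∈ Q, expChar x t‖ ^ (2 * k) : ℝ) : ℂ) =
        (∑ x ∈ Q, expChar x t) ^ k * (starRingEnd ℂ) ((∑ x ∈ Q, expChar x t) ^ k) := by
      rw [Complex.mul_conj', norm_pow]
      push_cast
      rw [← pow_mul, mul_comm]
    rw [h1, hpow, map_sum, sum_mul_sum, sum_product]
    refine sum_congr rfl fun f _ => sum_congr rfl fun g _ => ?_
    rw [sub_eq_add_neg, expChar_add, expChar_neg]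
  have hcard : Tk Q k = ((B ×ˢ B).filter fun p => ∑ i, p.1 i = ∑ i, p.2 i).card := by
    rw [Tk, Nat.subtype_card]
    simp [hB, Fintype.mem_piFinset, and_assoc]
  apply Complex.ofReal_injective
  rw [← intervalIntegral.integral_ofReal]
  simp only [hnorm]
  rw [intervalIntegral.integral_finsetSum fun p _ =>
    (continuous_expChar _).intervalIntegrable _ _]
  simp only [integral_expChar, sub_eq_zero]
  rw [← sum_filter, sum_const, hcard]
  simp
  ring

theorem Tk_one_le (Q : Finset ℤ) : Tk Q 1 ≤ Q.card := by
  rw [Tk, ← Nat.card_eq_finsetCard Q]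
  refine Nat.card_le_card_of_injective (fun f => ⟨f.1.1 0, f.2.1 0⟩) ?_
  rintro ⟨⟨f, g⟩, hf, hg, h⟩ ⟨⟨f', g'⟩, hf', hg', h'⟩ heq
  simp only [Fin.sum_univ_one] at h h'
  simp only [Subtype.mk.injEq, Prod.mk.injEq] at heq ⊢
  constructor <;> funext i <;> rw [Subsingleton.elim i 0]
  · exact heq
  · rw [← h, ← h', heq]

theorem continuous_expSum (Q : Finset ℤ) : Continuous fun t => ∑ x ∈ Q, expChar x t :=
  continuous_finsetSum _ fun x _ => continuous_expChar x

theorem Tk_le_card_pow (Q : Finset ℤ) {k : ℕ} (hk : 0 < k) : Tk Q k ≤ Q.card ^ (2 * k - 1) := by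
  have hcont := continuous_expSum Q
  have hpi := Real.pi_pos
  have h : ∫ t in (0 : ℝ)..(2 * Real.pi), ‖∑ x ∈ Q, expChar x t‖ ^ (2 * k) ≤
      ∫ t in (0 : ℝ)..(2 * Real.pi),
        (Q.card : ℝ) ^ (2 * k - 2) * ‖∑ x ∈ Q, expChar x t‖ ^ (2 * 1) := by
    refine intervalIntegral.integral_mono_on (μ := MeasureTheory.volume) (by positivity)
      ((hcont.norm.pow _).intervalIntegrable _ _)
      ((continuous_const.mul (hcont.norm.pow _)).intervalIntegrable _ _) fun t _ => ?_
    have hle : ‖∑ x ∈ Q, expChar x t‖ ≤ Q.card := by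
      refine (norm_sum_le _ _).trans ?_
      simp [norm_expChar]
    rw [show 2 * k = 2 * k - 2 + 2 * 1 by omega, pow_add, Nat.add_sub_cancel]
    gcongr
  rw [intervalIntegral.integral_const_mul, integral_norm_expSum_pow, integral_norm_expSum_pow] at h
  have h1 : (Tk Q 1 : ℝ) ≤ Q.card := by exact_mod_cast Tk_one_le Q
  have h2 : (Tk Q k : ℝ) ≤ Q.card ^ (2 * k - 2) * Tk Q 1 := by
    refine le_of_mul_le_mul_left ?_ (by positivity : 0 < 2 * Real.pi)
    linarith
  have h3 : (Tk Q k : ℝ) ≤ Q.card ^ (2 * k - 1) := by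
    refine h2.trans ?_
    rw [show 2 * k - 1 = 2 * k - 2 + 1 by omega, pow_succ]
    gcongr
  exact_mod_cast h3

theorem integral_esymm_eq_zero {m n : ℕ} (hn : 0 < n) {S : Finset ℕ} {a : ℕ → ℝ → ℝ}
    (hcont : ∀ i, Continuous (a i))
    (ha : ∀ i ∈ S, (fun t => (a i t : ℂ)) ∈ trigSpan {x | 4 ^ i * m < 2 * |x| ∧ |x| ≤ 4 ^ i * m}) :
    ∫ t in (0 : ℝ)..(2 * Real.pi),
      ∑ A ∈ powersetCard n (univ : Finset S), ∏ i ∈ A, a i t = 0 := by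
  have hprod : ∀ A : Finset S, Continuous fun t => ∏ i ∈ A, a i t := fun A => by fun_prop
  rw [intervalIntegral.integral_finsetSum fun A _ => (hprod A).intervalIntegrable _ _]
  refine sum_eq_zero fun A hA => ?_
  have hA' : A.Nonempty := card_pos.1 (by rw [(mem_powersetCard.1 hA).2]; exact hn)
  have := integral_prod_eq_zero (m := m) (g := fun i t => (a i t : ℂ))
    (A := A.map (Function.Embedding.subtype _)) (by simpa using hA') (by
      intro i hi
      obtain ⟨j, _, rfl⟩ := mem_map.1 hi
      exact ha _ j.2)
  simp only [prod_map, Function.Embedding.subtype_apply, ← Complex.ofReal_prod] at this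
  rw [intervalIntegral.integral_ofReal] at this
  exact_mod_cast this

/-- A Khinchin-type inequality for real functions with spectra in well separated scales. -/
theorem integral_sum_pow_le {m k : ℕ} (hk : 0 < k) {S : Finset ℕ} (hS : 20 * k ≤ S.card)
    {a : ℕ → ℝ → ℝ} (hcont : ∀ i, Continuous (a i))
    (ha : ∀ i ∈ S, (fun t => (a i t : ℂ)) ∈ trigSpan {x | 4 ^ i * m < 2 * |x| ∧ |x| ≤ 4 ^ i * m}) :
    ∫ t in (0 : ℝ)..(2 * Real.pi), (∑ i ∈ S, a i t) ^ (2 * k) ≤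
      2 * (125 * k) ^ k * (S.card : ℝ) ^ (k - 1) *
        ∫ t in (0 : ℝ)..(2 * Real.pi), ∑ i ∈ S, a i t ^ (2 * k) := by
  have hpi := Real.pi_pos
  have hcE : Continuous fun t =>
      ∑ A ∈ powersetCard (2 * k) (univ : Finset S), ∏ i ∈ A, a i t := by fun_prop
  have hcW : Continuous fun t => ∑ i ∈ S, a i t ^ (2 * k) := by fun_prop
  have hcF : Continuous fun t => (∑ i ∈ S, a i t) ^ (2 * k) := by fun_prop
  have hcR : Continuous fun t =>
      (4 ^ k * (2 * k).factorial : ℝ) *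
          ∑ A ∈ powersetCard (2 * k) (univ : Finset S), ∏ i ∈ A, a i t +
        2 * (125 * k) ^ k * (S.card : ℝ) ^ (k - 1) * ∑ i ∈ S, a i t ^ (2 * k) := by fun_prop
  have h := intervalIntegral.integral_mono_on (μ := MeasureTheory.volume)
    (by positivity : (0 : ℝ) ≤ 2 * Real.pi)
    (hcF.intervalIntegrable _ _) (hcR.intervalIntegrable _ _)
    (fun t _ => by
      have := sum_pow_le_esymm_add (fun i : S => a i t) hk (by simpa using hS)
      rw [sum_coe_sort S fun i => a i t, sum_coe_sort S fun i => a i t ^ (2 * k),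
        Fintype.card_coe] at this
      exact this)
  rw [intervalIntegral.integral_add ((hcE.const_mul _).intervalIntegrable _ _)
    ((hcW.const_mul _).intervalIntegrable _ _), intervalIntegral.integral_const_mul,
    intervalIntegral.integral_const_mul, integral_esymm_eq_zero (by omega) hcont ha, mul_zero,
    zero_add] at h
  exact h

theorem integral_norm_sum_pow_le {m k : ℕ} (hk : 0 < k) {S : Finset ℕ} {Qf : ℕ → Finset ℤ}
    (hQ : ∀ i ∈ S, ∀ x ∈ Qf i, 4 ^ i * (m : ℤ) < 2 * |x| ∧ |x| ≤ 4 ^ i * m) :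
    ∫ t in (0 : ℝ)..(2 * Real.pi), ‖∑ i ∈ S, ∑ x ∈ Qf i, expChar x t‖ ^ (2 * k) ≤
      (256 * k) ^ k * (S.card : ℝ) ^ (k - 1) *
        ∫ t in (0 : ℝ)..(2 * Real.pi), ∑ i ∈ S, ‖∑ x ∈ Qf i, expChar x t‖ ^ (2 * k) := by
  have hpi := Real.pi_pos
  have hcf : ∀ i, Continuous fun t => ‖∑ x ∈ Qf i, expChar x t‖ :=
    fun i => (continuous_expSum (Qf i)).norm
  have hcW : Continuous fun t => ∑ i ∈ S, ‖∑ x ∈ Qf i, expChar x t‖ ^ (2 * k) := by fun_prop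
  have hcF : Continuous fun t => ‖∑ i ∈ S, ∑ x ∈ Qf i, expChar x t‖ ^ (2 * k) :=
    (continuous_finsetSum _ fun i _ => continuous_expSum (Qf i)).norm.pow _
  have hW0 : 0 ≤ ∫ t in (0 : ℝ)..(2 * Real.pi),
      ∑ i ∈ S, ‖∑ x ∈ Qf i, expChar x t‖ ^ (2 * k) :=
    intervalIntegral.integral_nonneg (by positivity) fun t _ => by positivity
  rcases le_total (20 * k) S.card with hS | hS
  · set a : ℕ → ℝ → ℝ := fun i t => ∑ x ∈ Qf i, Real.cos (x * t) with ha
    set b : ℕ → ℝ → ℝ := fun i t => ∑ x ∈ Qf i, Real.sin (x * t) with hb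
    have hca : ∀ i, Continuous (a i) := fun i => by simp only [ha]; fun_prop
    have hcb : ∀ i, Continuous (b i) := fun i => by simp only [hb]; fun_prop
    have hneg : ∀ i : ℕ, ∀ x ∈ {x : ℤ | 4 ^ i * (m : ℤ) < 2 * |x| ∧ |x| ≤ 4 ^ i * m},
        -x ∈ {x : ℤ | 4 ^ i * (m : ℤ) < 2 * |x| ∧ |x| ≤ 4 ^ i * m} := fun i x hx => by
      simpa only [Set.mem_ofPred_eq, abs_neg] using hx
    have hIa := integral_sum_pow_le hk hS hca
      fun i hi => sum_cos_mem_trigSpan (hneg i) (hQ i hi)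
    have hIb := integral_sum_pow_le hk hS hcb
      fun i hi => sum_sin_mem_trigSpan (hneg i) (hQ i hi)
    have hf : ∀ i t, ∑ x ∈ Qf i, expChar x t = (a i t : ℂ) + (b i t : ℂ) * Complex.I :=
      fun i t => by
        simp only [ha, hb, expChar_eq, sum_add_distrib, sum_mul, Complex.ofReal_sum]
    have hfsq : ∀ i t, ‖∑ x ∈ Qf i, expChar x t‖ ^ 2 = a i t ^ 2 + b i t ^ 2 := fun i t => by
      rw [hf, Complex.sq_norm, Complex.normSq_add_mul_I]
    have hFsq : ∀ t, ‖∑ i ∈ S, ∑ x ∈ Qf i, expChar x t‖ ^ 2 =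
        (∑ i ∈ S, a i t) ^ 2 + (∑ i ∈ S, b i t) ^ 2 := fun t => by
      simp only [hf]
      rw [sum_add_distrib, ← sum_mul, ← Complex.ofReal_sum, ← Complex.ofReal_sum, Complex.sq_norm,
        Complex.normSq_add_mul_I]
    have hcA : Continuous fun t => (∑ i ∈ S, a i t) ^ (2 * k) := by fun_prop
    have hcB : Continuous fun t => (∑ i ∈ S, b i t) ^ (2 * k) := by fun_prop
    have hcA' : Continuous fun t => ∑ i ∈ S, a i t ^ (2 * k) := by fun_prop
    have hcB' : Continuous fun t => ∑ i ∈ S, b i t ^ (2 * k) := by fun_prop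
    have hcR : Continuous fun t => (2 : ℝ) ^ (k - 1) *
        ((∑ i ∈ S, a i t) ^ (2 * k) + (∑ i ∈ S, b i t) ^ (2 * k)) := by fun_prop
    have hcL : Continuous fun t => ∑ i ∈ S, a i t ^ (2 * k) + ∑ i ∈ S, b i t ^ (2 * k) := by
      fun_prop
    have h1 := intervalIntegral.integral_mono_on (μ := MeasureTheory.volume) (by positivity : (0 : ℝ) ≤ 2 * Real.pi)
      (hcF.intervalIntegrable _ _)
      (hcR.intervalIntegrable _ _) (fun t _ => by
        rw [pow_mul, hFsq, pow_mul, pow_mul]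
        exact add_pow_le (sq_nonneg _) (sq_nonneg _) k)
    have h2 := intervalIntegral.integral_mono_on (μ := MeasureTheory.volume) (by positivity : (0 : ℝ) ≤ 2 * Real.pi)
      (hcL.intervalIntegrable _ _) (hcW.intervalIntegrable _ _) (fun t _ => by
        rw [← sum_add_distrib]
        refine sum_le_sum fun i _ => ?_
        rw [pow_mul, pow_mul, pow_mul, hfsq]
        exact pow_add_pow_le (sq_nonneg _) (sq_nonneg _) hk.ne')
    rw [intervalIntegral.integral_const_mul, intervalIntegral.integral_add
      (hcA.intervalIntegrable _ _) (hcB.intervalIntegrable _ _)] at h1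
    rw [intervalIntegral.integral_add (hcA'.intervalIntegrable _ _)
      (hcB'.intervalIntegrable _ _)] at h2
    refine h1.trans ?_
    refine (mul_le_mul_of_nonneg_left (add_le_add hIa hIb) (by positivity)).trans ?_
    rw [← mul_add, ← mul_assoc]
    refine mul_le_mul ?_ h2 (by
      refine add_nonneg ?_ ?_ <;>
        exact intervalIntegral.integral_nonneg (by positivity) fun t _ =>
          sum_nonneg fun i _ => (even_two_mul k).pow_nonneg _) (by positivity)
    have hconst : (2 : ℝ) ^ (k - 1) * (2 * (125 * k) ^ k) ≤ (256 * k) ^ k := by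
      rw [← mul_assoc, ← pow_succ, Nat.sub_add_cancel hk, ← mul_pow]
      refine pow_le_pow_left₀ (by positivity) ?_ k
      have : (0 : ℝ) ≤ k := by positivity
      linarith
    rw [← mul_assoc]
    gcongr
  · have h := intervalIntegral.integral_mono_on (μ := MeasureTheory.volume) (by positivity : (0 : ℝ) ≤ 2 * Real.pi)
      (hcF.intervalIntegrable _ _)
      ((hcW.const_mul ((S.card : ℝ) ^ (2 * k - 1))).intervalIntegrable _ _) (fun t _ => by
        refine (pow_le_pow_left₀ (norm_nonneg _) (norm_sum_le _ _) _).trans ?_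
        have h := pow_sum_le_card_mul_sum_pow (s := S)
          (f := fun i => ‖∑ x ∈ Qf i, expChar x t‖) (fun i _ => norm_nonneg _) (2 * k - 1)
        rwa [Nat.sub_add_cancel (by omega)] at h)
    rw [intervalIntegral.integral_const_mul] at h
    refine h.trans (mul_le_mul_of_nonneg_right ?_ hW0)
    rw [show 2 * k - 1 = k + (k - 1) by omega, pow_add]
    have hS' : (S.card : ℝ) ≤ 20 * k := by exact_mod_cast hS
    gcongr
    have : (0 : ℝ) ≤ k := by positivity
    linarith
theorem Tk_scattered (I k m M : ℕ) (hI : 0 < I) (hk : 0 < k) (hm : 0 < m) (hM : 0 < M)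
    (S : Finset ℕ) (hS : S.card = I) (Qf : ℕ → Finset ℤ)
    (hdisj : ∀ i ∈ S, ∀ j ∈ S, i ≠ j → Disjoint (Qf i) (Qf j))
    (hrange : ∀ i ∈ S, ∀ x ∈ Qf i,
      (-(4 ^ i * m : ℤ) ≤ x ∧ 2 * x < -(4 ^ i * m : ℤ)) ∨
      ((4 ^ i * m : ℤ) < 2 * x ∧ x ≤ (4 ^ i * m : ℤ)))
    (hcard : ∀ i ∈ S, (Qf i).card = M)
    (Q : Finset ℤ) (hQ : Q = S.biUnion Qf) :
    Tk Q k ≤ 2 ^ (8 * k) * k ^ k * I ^ k * M ^ (2 * k - 1) := by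
  have hpi := Real.pi_pos
  have habs : ∀ i ∈ S, ∀ x ∈ Qf i, 4 ^ i * (m : ℤ) < 2 * |x| ∧ |x| ≤ 4 ^ i * m := by
    intro i hi x hx
    have hpos : (0 : ℤ) < 4 ^ i * m := by positivity
    rcases hrange i hi x hx with ⟨h1, h2⟩ | ⟨h1, h2⟩
    · rw [abs_of_neg (by linarith)]; constructor <;> linarith
    · rw [abs_of_pos (by linarith)]; exact ⟨h1, h2⟩
  have hsum : ∀ t, ∑ x ∈ Q, expChar x t = ∑ i ∈ S, ∑ x ∈ Qf i, expChar x t := fun t => by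
    rw [hQ, sum_biUnion fun i hi j hj hij => hdisj i hi j hj hij]
  have h := integral_norm_sum_pow_le hk habs
  simp only [← hsum] at h
  have hcont : ∀ i, Continuous fun t => ‖∑ x ∈ Qf i, expChar x t‖ ^ (2 * k) :=
    fun i => (continuous_expSum (Qf i)).norm.pow _
  rw [integral_norm_expSum_pow, intervalIntegral.integral_finsetSum fun i _ =>
    (hcont i).intervalIntegrable _ _] at h
  simp only [integral_norm_expSum_pow] at h
  rw [← mul_sum, hS] at h
  have hT : ∑ i ∈ S, (Tk (Qf i) k : ℝ) ≤ I * (M : ℝ) ^ (2 * k - 1) := by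
    refine (sum_le_card_nsmul S _ ((M : ℝ) ^ (2 * k - 1)) fun i hi => ?_).trans_eq (by simp [hS])
    have := Tk_le_card_pow (Qf i) hk
    rw [hcard i hi] at this
    exact_mod_cast this
  have key : (Tk Q k : ℝ) ≤ 2 ^ (8 * k) * k ^ k * I ^ k * M ^ (2 * k - 1) := by
    refine le_of_mul_le_mul_left (h.trans ?_) (by positivity : 0 < 2 * Real.pi)
    calc (256 * k : ℝ) ^ k * I ^ (k - 1) * (2 * Real.pi * ∑ i ∈ S, (Tk (Qf i) k : ℝ))
        ≤ (256 * k : ℝ) ^ k * I ^ (k - 1) * (2 * Real.pi * (I * (M : ℝ) ^ (2 * k - 1))) := by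
          gcongr
      _ = 2 * Real.pi * (256 ^ k * k ^ k * I ^ (k - 1 + 1) * M ^ (2 * k - 1)) := by ring
      _ = 2 * Real.pi * (2 ^ (8 * k) * k ^ k * I ^ k * M ^ (2 * k - 1)) := by
          rw [Nat.sub_add_cancel hk, pow_mul]; norm_num
  exact_mod_cast key
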